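/- Suppose E[G²] < ∞. Then for q = 2, δ > 1 and ε ∈ (0,1), as σ_w → 0: AMSE(σ_w) = σ_w²/(1 − 1/δ) − [δ³ / ((δ−1)³ · ε · E|G|²)] · σ_w⁴ + o(σ_w⁴). -/

import Mathlib

open MeasureTheory ProbabilityTheory Real Filter Set Asymptotics

noncomputable section

/-- The standard Gaussian measure on `ℝ`. -/
def stdGaussian : Measure ℝ := gaussianReal 0 1

/-- `η₂(u;χ) = u/(1+2χ)`, the proximal operator of `χ|·|²`. -/
def eta2 (u χ : ℝ) : ℝ := u / (1 + 2 * χ)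

/-- The law of `B`: the mixture `(1−ε)δ₀ + ε·g`. -/
def mix (ε : ℝ) (g : Measure ℝ) : Measure ℝ :=
  ENNReal.ofReal (1 - ε) • Measure.dirac (0:ℝ) + ENNReal.ofReal ε • g

/-- `min_{χ ≥ 0} E[(η(B+σZ;χ) − B)²]` where `B ~ μB`, `Z ~ N(0,1)` independent. -/
def riskMin (η : ℝ → ℝ → ℝ) (μB : Measure ℝ) (σ : ℝ) : ℝ :=
  ⨅ χ : NNReal, ∫ b, (∫ z, (η (b + σ * z) (χ:ℝ) - b)^2 ∂stdGaussian) ∂μB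

instance : IsProbabilityMeasure stdGaussian :=
  inferInstanceAs (IsProbabilityMeasure (gaussianReal 0 1))

lemma memLp_id_stdGaussian : MemLp (fun z : ℝ => z) 2 stdGaussian :=
  memLp_id_gaussianReal 2

lemma integral_id_stdGaussian_real : ∫ z, z ∂stdGaussian = 0 :=
  integral_id_gaussianReal

lemma integral_sq_stdGaussian : ∫ z, z ^ 2 ∂stdGaussian = 1 := by
  have h := variance_eq_sub (X := fun z : ℝ => z) memLp_id_stdGaussian
  have hv : variance (fun z : ℝ => z) stdGaussian = 1 := by
    exact_mod_cast variance_fun_id_gaussianReal (μ := 0) (v := 1)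
  rw [hv, integral_id_stdGaussian_real] at h
  simpa [Pi.pow_apply] using h.symm

lemma integral_affine_sq_stdGaussian (p r : ℝ) :
    ∫ z, (p + r * z) ^ 2 ∂stdGaussian = p ^ 2 + r ^ 2 := by
  have h₁ : Integrable (fun z : ℝ => 2 * p * r * z) stdGaussian :=
    (memLp_id_stdGaussian.integrable one_le_two).const_mul _
  have h₂ : Integrable (fun z : ℝ => r ^ 2 * z ^ 2) stdGaussian :=
    memLp_id_stdGaussian.integrable_sq.const_mul _
  have h : (fun z : ℝ => (p + r * z) ^ 2) =
      fun z => p ^ 2 + 2 * p * r * z + r ^ 2 * z ^ 2 := by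
    ext z
    ring
  have h₀ : Integrable (fun z : ℝ => p ^ 2 + 2 * p * r * z) stdGaussian :=
    (integrable_const _).add h₁
  rw [h, integral_add h₀ h₂, integral_add (integrable_const _) h₁,
    integral_const_mul, integral_const_mul, integral_id_stdGaussian_real, integral_sq_stdGaussian]
  simp

/-- The integral of a quadratic without linear term against the mixture `(1−ε)δ₀ + ε·g`. -/
lemma integral_quadratic_mix {ε : ℝ} (hε : ε ∈ Ioo (0 : ℝ) 1) (g : Measure ℝ)
    [IsProbabilityMeasure g] (hG2 : Integrable (fun x => x ^ 2) g) (c d : ℝ) :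
    ∫ b, (c * b ^ 2 + d) ∂(mix ε g) = c * (ε * ∫ x, x ^ 2 ∂g) + d := by
  have hg : Integrable (fun b => c * b ^ 2 + d) g :=
    (hG2.const_mul c).add (integrable_const d)
  have h₀ : Integrable (fun b : ℝ => c * b ^ 2 + d) (Measure.dirac 0) :=
    integrable_dirac (by simp)
  rw [mix, integral_add_measure (h₀.smul_measure ENNReal.ofReal_ne_top)
    (hg.smul_measure ENNReal.ofReal_ne_top), integral_smul_measure, integral_smul_measure,
    integral_dirac, integral_add (hG2.const_mul c) (integrable_const d), integral_const_mul,
    ENNReal.toReal_ofReal (by linarith [hε.2]), ENNReal.toReal_ofReal hε.1.le]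
  simp
  ring

lemma risk_eta2_mix {ε : ℝ} (hε : ε ∈ Ioo (0 : ℝ) 1) (g : Measure ℝ)
    [IsProbabilityMeasure g] (hG2 : Integrable (fun x => x ^ 2) g) (σ χ : ℝ) :
    ∫ b, (∫ z, (eta2 (b + σ * z) χ - b) ^ 2 ∂stdGaussian) ∂(mix ε g) =
      ((1 + 2 * χ)⁻¹ - 1) ^ 2 * (ε * ∫ x, x ^ 2 ∂g) + ((1 + 2 * χ)⁻¹ * σ) ^ 2 := by
  have h (b : ℝ) : ∫ z, (eta2 (b + σ * z) χ - b) ^ 2 ∂stdGaussian =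
      ((1 + 2 * χ)⁻¹ - 1) ^ 2 * b ^ 2 + ((1 + 2 * χ)⁻¹ * σ) ^ 2 := by
    rw [← mul_pow, ← integral_affine_sq_stdGaussian]
    refine integral_congr_ae (.of_forall fun z => ?_)
    simp only [eta2, div_eq_mul_inv]
    ring
  simp_rw [h]
  exact integral_quadratic_mix hε g hG2 _ _

/-- The optimally tuned ridge risk in closed form. -/
lemma riskMin_eta2_mix {ε : ℝ} (hε : ε ∈ Ioo (0 : ℝ) 1) (g : Measure ℝ)
    [IsProbabilityMeasure g] (hG2 : Integrable (fun x => x ^ 2) g)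
    (hpos : 0 < ∫ x, x ^ 2 ∂g) (σ : ℝ) :
    riskMin eta2 (mix ε g) σ =
      (ε * ∫ x, x ^ 2 ∂g) * σ ^ 2 / ((ε * ∫ x, x ^ 2 ∂g) + σ ^ 2) := by
  have hM : 0 < ε * ∫ x, x ^ 2 ∂g := mul_pos hε.1 hpos
  simp only [riskMin, risk_eta2_mix hε g hG2]
  set M := ε * ∫ x, x ^ 2 ∂g
  have hMσ : 0 < M + σ ^ 2 := by positivity
  apply le_antisymm
  · refine (ciInf_le ⟨0, ?_⟩ (NNReal.mk (σ ^ 2 / (2 * M)) (by positivity))).trans_eq ?_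
    · rintro _ ⟨χ, rfl⟩
      positivity
    · have : (1 + 2 * (σ ^ 2 / (2 * M)))⁻¹ = M / (M + σ ^ 2) := by
        field_simp
      simp only [NNReal.coe_mk, this]
      field_simp
      ring
  · refine le_ciInf fun χ => ?_
    rw [div_le_iff₀ hMσ]
    generalize (1 + 2 * (χ : ℝ))⁻¹ = a
    linarith [sq_nonneg (a * (M + σ ^ 2) - M)]

lemma integral_sq_pos {g : Measure ℝ} [IsProbabilityMeasure g] (hg0 : g {0} = 0)
    (hG2 : Integrable (fun x => x ^ 2) g) : 0 < ∫ x, x ^ 2 ∂g := by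
  rw [integral_pos_iff_support_of_nonneg (fun x => sq_nonneg x) hG2]
  have h : Function.support (fun x : ℝ => x ^ 2) = {0}ᶜ := by
    ext x
    simp
  rw [h, prob_compl_eq_one_sub (measurableSet_singleton 0), hg0]
  simp

/-- A quantitative second-order expansion, in `t`, of `M v / (M + v)` at the solution `v` of
`v = t + M v / (δ (M + v))`. -/
lemma abs_fixedPoint_expansion_le {δ M t v : ℝ} (hδ : 1 < δ) (hM : 0 < M) (hv : 0 < v)
    (h : v = t + (1 / δ) * (M * v / (M + v))) :
    |M * v / (M + v) - (t / (1 - 1 / δ) - δ ^ 3 / ((δ - 1) ^ 3 * M) * t ^ 2)| ≤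
      (δ / (δ - 1)) ^ 4 * (2 * (δ / (δ - 1)) / δ + 1) / M ^ 2 * t ^ 3 := by
  have hδ1 : 0 < δ - 1 := by linarith
  have hδ0 : 0 < δ := by linarith
  obtain ⟨k, hk⟩ : ∃ k, k = δ / (δ - 1) := ⟨_, rfl⟩
  have hk0 : 0 < k := by rw [hk]; positivity
  obtain ⟨w, hw⟩ : ∃ w, w = v ^ 2 / (M + v) := ⟨_, rfl⟩
  have hw0 : 0 ≤ w := by rw [hw]; positivity
  have hwM : w ≤ v ^ 2 / M := by
    rw [hw]
    gcongr
    linarith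
  have hR : M * v / (M + v) = v - w := by rw [hw]; field_simp; ring
  have hvt : k * t - v = k / δ * w := by
    have : t = v - (1 / δ) * (v - w) := by rw [hR] at h; linarith
    rw [this, hk]
    field_simp
    ring
  have hle : v ≤ k * t := by
    have : 0 ≤ k / δ * w := by positivity
    linarith
  have hkt : 0 < k * t := hv.trans_le hle
  have hwkt : w ≤ (k * t) ^ 2 / M := hwM.trans (by gcongr)
  have hgap : (k * t) ^ 2 - v ^ 2 ≤ k / δ * ((k * t) ^ 2 / M) * (2 * (k * t)) := by
    have : (k * t) ^ 2 - v ^ 2 = k / δ * w * (k * t + v) := by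
      rw [← hvt]; ring
    rw [this]
    gcongr
    linarith
  have hgap0 : 0 ≤ (k * t) ^ 2 - v ^ 2 := sub_nonneg.2 (by gcongr)
  have hrem : v ^ 2 / M - w ≤ (k * t) ^ 3 / M ^ 2 := by
    have : v ^ 2 / M - w = v ^ 3 / (M * (M + v)) := by rw [hw]; field_simp; ring
    rw [this]
    have : M ^ 2 ≤ M * (M + v) := by nlinarith
    gcongr
  have key : M * v / (M + v) - (t / (1 - 1 / δ) - δ ^ 3 / ((δ - 1) ^ 3 * M) * t ^ 2) =
      k * (((k * t) ^ 2 - v ^ 2) / M + (v ^ 2 / M - w)) := by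
    have h₁ : t / (1 - 1 / δ) = k * t := by rw [hk]; field_simp
    have h₂ : δ ^ 3 / ((δ - 1) ^ 3 * M) * t ^ 2 = k * ((k * t) ^ 2 / M) := by
      rw [hk]; field_simp
    have h₃ : k / δ = k - 1 := by rw [hk]; field_simp; ring
    rw [h₃] at hvt
    rw [hR, h₁, h₂, sub_div]
    linarith
  have hnn : 0 ≤ k * (((k * t) ^ 2 - v ^ 2) / M + (v ^ 2 / M - w)) :=
    mul_nonneg hk0.le (add_nonneg (div_nonneg hgap0 hM.le) (sub_nonneg.2 hwM))
  rw [key, abs_of_nonneg hnn, ← hk]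
  calc k * (((k * t) ^ 2 - v ^ 2) / M + (v ^ 2 / M - w))
      ≤ k * (k / δ * ((k * t) ^ 2 / M) * (2 * (k * t)) / M + (k * t) ^ 3 / M ^ 2) := by gcongr
    _ = k ^ 4 * (2 * k / δ + 1) / M ^ 2 * t ^ 3 := by field_simp

/-- Second-order small-error expansion of the optimally-tuned AMSE for `q = 2`, `δ > 1`:
`AMSE(σ_w) = σ_w²/(1−1/δ) − [δ³/((δ−1)³ ε E|G|²)]·σ_w⁴ + o(σ_w⁴)` as `σ_w → 0⁺`.
Here `σb σ_w` is the unique positive solution `σ̄` of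
`σ̄² = σ_w² + (1/δ)·min_{χ≥0}E[(η₂(B+σ̄Z;χ)−B)²]` and `AMSE(σ_w) = riskMin eta2 (mix ε g) (σb σ_w)`. -/
theorem amse_expansion_q_two
    (δ ε : ℝ) (hδ : 1 < δ) (hε : ε ∈ Ioo (0:ℝ) 1)
    (g : Measure ℝ) [IsProbabilityMeasure g] (hg0 : g {0} = 0)
    (hG2 : Integrable (fun x => x^2) g)
    (σb : ℝ → ℝ)
    (hσb : ∀ s, 0 < s → 0 < σb s ∧
      (σb s) ^ 2 = s ^ 2 + (1/δ) * riskMin eta2 (mix ε g) (σb s)) :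
    (fun s => riskMin eta2 (mix ε g) (σb s) -
        (s ^ 2 / (1 - 1/δ) -
          (δ ^ 3 / ((δ - 1) ^ 3 * ε * ∫ x, x^2 ∂g)) * s ^ 4))
      =o[nhdsWithin (0:ℝ) (Ioi 0)] (fun s => s ^ 4) := by
  have hpos := integral_sq_pos hg0 hG2
  have hO : (fun s => riskMin eta2 (mix ε g) (σb s) -
        (s ^ 2 / (1 - 1/δ) -
          (δ ^ 3 / ((δ - 1) ^ 3 * ε * ∫ x, x^2 ∂g)) * s ^ 4))
      =O[nhdsWithin (0:ℝ) (Ioi 0)] (fun s => s ^ 6) := by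
    refine IsBigO.of_bound ((δ / (δ - 1)) ^ 4 * (2 * (δ / (δ - 1)) / δ + 1) /
      (ε * ∫ x, x ^ 2 ∂g) ^ 2) (eventually_nhdsWithin_of_forall fun s hs => ?_)
    obtain ⟨hσ, h⟩ := hσb s hs
    simp only [riskMin_eta2_mix hε g hG2 hpos] at h ⊢
    have := abs_fixedPoint_expansion_le hδ (mul_pos hε.1 hpos) (pow_pos hσ 2) h
    simpa [← pow_mul, ← mul_assoc, abs_of_pos (show 0 < s from hs)] using this
  exact hO.trans_isLittleO
    ((isLittleO_pow_pow (by norm_num : 4 < 6)).mono nhdsWithin_le_nhds)
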